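/- Let n ≥ 1, let E : Fin n → Fin n → Prop be a decidable edge relation, let the source be 0 : Fin n, fix d : ℕ and a vertex x : Fin n with x ≠ 0. Define the relation β on Fin n × ℕ by β (v, c) (v', c') := ((v' : ℕ) = (v : ℕ) + 1) ∧ (c' = c ∨ (c' = c + 1 ∧ v' ≠ x ∧ reachIn E d 0 v')). Then for all v : Fin n and c : ℕ, Relation.ReflTransGen β (0, 1) (v, c) holds if and only if 1 ≤ c and c ≤ card {w : Fin n | w ≤ v ∧ w ≠ x ∧ reachIn E d 0 w}. (Correctness of the counting relation β from Claim 1: a path in the auxiliary graph from (0,1) to (v,c) exists exactly when there are at least c vertices up to v, different from x, that are d-reachable from 0.) -/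

import Mathlib

/-- `x` is reachable from `s` by a path of length at most `d`. -/
def reachIn {V : Type*} (E : V → V → Prop) (d : ℕ) (s x : V) : Prop :=
  ∃ k ≤ d, ∃ v : ℕ → V, v 0 = s ∧ v k = x ∧ ∀ i < k, E (v i) (v (i + 1))

theorem reachIn_refl {V : Type*} (E : V → V → Prop) (d : ℕ) (s : V) : reachIn E d s s :=
  ⟨0, d.zero_le, fun _ => s, rfl, rfl, fun _ hi => absurd hi (Nat.not_lt_zero _)⟩

section Counting

variable {n : ℕ} {P : Fin n → Prop} {u v : Fin n}

theorem ncard_le_and_of_pos_of_val_eq_succ (h : (v : ℕ) = u + 1) (hv : P v) :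
    {w | w ≤ v ∧ P w}.ncard = {w | w ≤ u ∧ P w}.ncard + 1 := by
  have hins : {w | w ≤ v ∧ P w} = insert v {w | w ≤ u ∧ P w} := by
    ext w
    simp only [Set.mem_ofPred_eq, Set.mem_insert_iff, Fin.le_def, Fin.ext_iff]
    constructor
    · rintro ⟨hw, hP⟩
      by_cases hwv : (w : ℕ) = v
      · exact Or.inl hwv
      · exact Or.inr ⟨by omega, hP⟩
    · rintro (hw | ⟨hw, hP⟩)
      · exact ⟨hw.le, Fin.ext hw ▸ hv⟩
      · exact ⟨by omega, hP⟩
  rw [hins, Set.ncard_insert_of_notMem]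
  simp only [Set.mem_ofPred_eq, Fin.le_def]
  omega

theorem ncard_le_and_of_neg_of_val_eq_succ (h : (v : ℕ) = u + 1) (hv : ¬ P v) :
    {w | w ≤ v ∧ P w}.ncard = {w | w ≤ u ∧ P w}.ncard := by
  congr 1
  ext w
  refine and_congr_left fun hP => ?_
  have hwv : (w : ℕ) ≠ v := fun hw => hv (Fin.ext hw ▸ hP)
  simp only [Fin.le_def]
  omega

theorem one_le_ncard_le_and [NeZero n] (h0 : P 0) (v : Fin n) :
    1 ≤ {w | w ≤ v ∧ P w}.ncard :=
  (Set.ncard_pos (Set.toFinite _)).2 ⟨0, Fin.zero_le _, h0⟩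

theorem ncard_le_zero_and [NeZero n] (h0 : P 0) : {w | w ≤ 0 ∧ P w}.ncard = 1 := by
  refine Set.ncard_eq_one.2 ⟨0, ?_⟩
  ext w
  simp only [nonpos_iff_eq_zero, Set.mem_ofPred_eq, Set.mem_singleton_iff]
  exact ⟨And.left, fun hw => ⟨hw, hw ▸ h0⟩⟩

/-- In the graph on `Fin n × ℕ` whose edges increment the vertex and may increment the counter
when the new vertex satisfies `P`, the pair `(v, c)` is accessible from `(0, 1)` exactly when
`c` is positive and at most the number of vertices up to `v` satisfying `P`. -/
theorem reflTransGen_counting_iff [NeZero n] (h0 : P 0) (v : Fin n) (c : ℕ) :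
    Relation.ReflTransGen
      (fun p q : Fin n × ℕ =>
        ((q.1 : ℕ) = (p.1 : ℕ) + 1) ∧ (q.2 = p.2 ∨ (q.2 = p.2 + 1 ∧ P q.1)))
      (0, 1) (v, c)
    ↔ 1 ≤ c ∧ c ≤ {w | w ≤ v ∧ P w}.ncard := by
  constructor
  · suffices ∀ q : Fin n × ℕ, Relation.ReflTransGen
        (fun p q : Fin n × ℕ =>
          ((q.1 : ℕ) = (p.1 : ℕ) + 1) ∧ (q.2 = p.2 ∨ (q.2 = p.2 + 1 ∧ P q.1)))
        (0, 1) q → 1 ≤ q.2 ∧ q.2 ≤ {w | w ≤ q.1 ∧ P w}.ncard from this (v, c)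
    intro q hq
    induction hq with
    | refl => exact ⟨le_rfl, one_le_ncard_le_and h0 0⟩
    | @tail p q _ hpq ih =>
      obtain ⟨hsucc, hcount⟩ := hpq
      by_cases hP : P q.1
      · rw [ncard_le_and_of_pos_of_val_eq_succ hsucc hP]
        omega
      · rw [ncard_le_and_of_neg_of_val_eq_succ hsucc hP]
        have : q.2 = p.2 := hcount.resolve_right fun h => hP h.2
        omega
  · rintro ⟨hc, hcard⟩
    obtain ⟨m, hm⟩ : ∃ m, (v : ℕ) = m := ⟨v, rfl⟩
    induction m generalizing v c with
    | zero =>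
      obtain rfl : v = 0 := Fin.ext (by simpa using hm)
      rw [ncard_le_zero_and h0] at hcard
      obtain rfl : c = 1 := le_antisymm hcard hc
      exact .refl
    | succ m ih =>
      let u : Fin n := ⟨m, by omega⟩
      have hsucc : (v : ℕ) = u + 1 := hm
      by_cases hle : c ≤ {w | w ≤ u ∧ P w}.ncard
      · exact (ih u c hc hle rfl).tail ⟨hsucc, Or.inl rfl⟩
      · by_cases hP : P v
        · rw [ncard_le_and_of_pos_of_val_eq_succ hsucc hP] at hcard
          exact (ih u _ (one_le_ncard_le_and h0 u) le_rfl rfl).tail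
            ⟨hsucc, Or.inr ⟨by dsimp only; omega, hP⟩⟩
        · exact absurd (ncard_le_and_of_neg_of_val_eq_succ hsucc hP ▸ hcard) hle

end Counting

theorem beta_counting_correct {n : ℕ} [NeZero n]
    (E : Fin n → Fin n → Prop) [DecidableRel E] (d : ℕ) (x : Fin n) (hx : x ≠ 0) :
    ∀ (v : Fin n) (c : ℕ),
      Relation.ReflTransGen
        (fun p q : Fin n × ℕ =>
          ((q.1 : ℕ) = (p.1 : ℕ) + 1) ∧
            (q.2 = p.2 ∨ (q.2 = p.2 + 1 ∧ q.1 ≠ x ∧ reachIn E d 0 q.1)))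
        (0, 1) (v, c)
      ↔ 1 ≤ c ∧ c ≤ {w : Fin n | w ≤ v ∧ w ≠ x ∧ reachIn E d 0 w}.ncard := by
  exact reflTransGen_counting_iff (P := fun w => w ≠ x ∧ reachIn E d 0 w)
    ⟨hx.symm, reachIn_refl E d 0⟩
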